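/- arXiv:math/0012056 — 3 statements merged into one kernel-verified Lean document; each statement's English description precedes it below -/
import Mathlib

section
/- For any Young diagrams λ and μ with |λ| = |μ| and |μ| ≠ 0, the element c_{λ,μ} = v·(s^{-1} − s)·(∑_{c ∈ μ} s^{−2·cn(c)}) + v^{−1}·(s − s^{−1})·(∑_{c ∈ λ} s^{2·cn(c)}) is a nonzero element of the Laurent polynomial ring ℤ[v^{±1}, s^{±1}]. -/
/-- The Laurent polynomial ring `ℤ[v^{±1}, s^{±1}]`, realized as the group algebra of
`ℤ × ℤ` over `ℤ`: the monomial `v^a s^b` corresponds to `single (a, b) 1`. -/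
abbrev LaurentVS : Type := AddMonoidAlgebra ℤ (ℤ × ℤ)

/-- The monomial `v^a * s^b` in `ℤ[v^{±1}, s^{±1}]`. -/
noncomputable def vs (a b : ℤ) : LaurentVS := AddMonoidAlgebra.single (a, b) 1

/-- The content `cn(c) = j - i` of a cell `c = (i, j)` of a Young diagram. -/
def cn (c : ℕ × ℕ) : ℤ := (c.2 : ℤ) - (c.1 : ℤ)

/-- The element `c_{λ,μ} = v (s⁻¹ - s) ∑_{c ∈ μ} s^{-2 cn(c)} + v⁻¹ (s - s⁻¹) ∑_{c ∈ λ} s^{2 cn(c)}`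
of `ℤ[v^{±1}, s^{±1}]`. -/
noncomputable def cLM (lam mu : YoungDiagram) : LaurentVS :=
  vs 1 0 * (vs 0 (-1) - vs 0 1) * (∑ c ∈ mu.cells, vs 0 (-2 * cn c)) +
    vs (-1) 0 * (vs 0 1 - vs 0 (-1)) * (∑ c ∈ lam.cells, vs 0 (2 * cn c))

lemma vs_mul (a b c d : ℤ) : vs a b * vs c d = vs (a + c) (b + d) := by
  simp [vs, AddMonoidAlgebra.single_mul_single]

lemma exists_functional : ∃ f : LaurentVS →+ ℤ, ∀ a b, f (vs a b) = if a = 1 then b else 0 := by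
  refine ⟨(Finsupp.liftAddHom (fun p : ℤ × ℤ =>
    AddMonoidHom.mulRight (if p.1 = 1 then p.2 else 0))).comp
      (AddMonoidAlgebra.coeffAddEquiv (R := ℤ) (M := ℤ × ℤ)).toAddMonoidHom, ?_⟩
  intro a b
  simp [vs]

/-- For Young diagrams `λ`, `μ` with `|λ| = |μ|` and `|μ| ≠ 0`, the element `c_{λ,μ}` is a
nonzero element of `ℤ[v^{±1}, s^{±1}]`. -/
theorem cLM_ne_zero (lam mu : YoungDiagram) (hcard : lam.card = mu.card)
    (hmu : mu.card ≠ 0) : cLM lam mu ≠ 0 := by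
  obtain ⟨f, hf⟩ := exists_functional
  intro h
  have h2 := congrArg f h
  simp only [cLM, mul_sub, sub_mul, Finset.mul_sum, vs_mul, map_add, map_sub, map_sum, hf,
    map_zero] at h2
  norm_num [← Finset.sum_sub_distrib] at h2
  exact hmu (by simp [YoungDiagram.card, h2])
end

section
/- Let ℐ be the multiplicative submonoid of the Laurent polynomial ring ℤ[v^{±1}, s^{±1}] generated by the elements s^{2n} − 1 for all integers n > 0 together with the elements c_{λ,μ} for all pairs of Young diagrams λ, μ with |λ| = |μ| and |μ| ≠ 0. Then 0 ∉ ℐ; consequently the localization ℛ of ℤ[v^{±1}, s^{±1}] at ℐ is an integral domain and the canonical localization map ℤ[v^{±1}, s^{±1}] → ℛ is injective. -/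
/-- The generating set of the monoid `ℐ`: the elements `s^{2n} - 1` for integers `n > 0`
together with the elements `c_{λ,μ}` for Young diagrams `λ`, `μ` with `|λ| = |μ| ≠ 0`. -/
noncomputable def genSet : Set LaurentVS :=
  {y | ∃ n : ℕ, 0 < n ∧ y = vs 0 (2 * (n : ℤ)) - 1} ∪
    {y | ∃ lam mu : YoungDiagram, lam.card = mu.card ∧ mu.card ≠ 0 ∧ y = cLM lam mu}

/-- The multiplicative submonoid `ℐ` of `ℤ[v^{±1}, s^{±1}]` generated by `genSet`. -/
noncomputable def Imonoid : Submonoid LaurentVS := Submonoid.closure genSet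

/-- The evaluation character `v ↦ I`, `s ↦ 2`. -/
noncomputable def evalChar : Multiplicative (ℤ × ℤ) →* ℂ where
  toFun a := Complex.I ^ (a.toAdd.1) * (2 : ℂ) ^ (a.toAdd.2)
  map_one' := by simp
  map_mul' a b := by
    simp only [toAdd_mul, Prod.fst_add, Prod.snd_add]
    rw [zpow_add₀ Complex.I_ne_zero, zpow_add₀ two_ne_zero]
    ring

/-- The evaluation ring homomorphism `v ↦ I`, `s ↦ 2`. -/
noncomputable def evalHom : LaurentVS →ₐ[ℤ] ℂ := AddMonoidAlgebra.lift ℤ ℂ (ℤ × ℤ) evalChar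

lemma evalHom_vs (a b : ℤ) : evalHom (vs a b) = Complex.I ^ a * (2 : ℂ) ^ b := by
  simp [evalHom, vs, AddMonoidAlgebra.lift_single, evalChar]

lemma evalHom_cLM (lam mu : YoungDiagram) : evalHom (cLM lam mu) =
    Complex.I * (((-3 / 2) * (∑ c ∈ mu.cells, (2 : ℝ) ^ (-2 * cn c) +
      ∑ c ∈ lam.cells, (2 : ℝ) ^ (2 * cn c)) : ℝ) : ℂ) := by
  simp only [cLM, map_add, map_mul, map_sub, map_sum, evalHom_vs]
  push_cast
  simp only [zpow_zero, zpow_one, zpow_neg_one, Complex.inv_I, one_mul, mul_one]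
  ring

lemma evalHom_gen {y : LaurentVS} (hy : y ∈ genSet) : evalHom y ≠ 0 := by
  rcases hy with ⟨n, hn, rfl⟩ | ⟨lam, mu, _, hmu, rfl⟩
  · rw [map_sub, map_one, evalHom_vs, zpow_zero, one_mul, sub_ne_zero]
    have h : (1 : ℝ) < (2 : ℝ) ^ (2 * (n : ℤ)) := one_lt_zpow₀ (by norm_num) (by omega)
    exact_mod_cast h.ne'
  · rw [evalHom_cLM]
    refine mul_ne_zero Complex.I_ne_zero (Complex.ofReal_ne_zero.mpr ?_)
    have h1 : 0 < ∑ c ∈ mu.cells, (2 : ℝ) ^ (-2 * cn c) :=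
      Finset.sum_pos (fun c _ => by positivity) (Finset.card_ne_zero.mp hmu)
    have h2 : 0 ≤ ∑ c ∈ lam.cells, (2 : ℝ) ^ (2 * cn c) :=
      Finset.sum_nonneg (fun c _ => by positivity)
    apply ne_of_lt
    linarith

lemma zero_notMem_Imonoid : (0 : LaurentVS) ∉ Imonoid := by
  have h : Imonoid ≤ (nonZeroDivisors ℂ).comap (evalHom : LaurentVS →* ℂ) :=
    Submonoid.closure_le.mpr fun y hy => mem_nonZeroDivisors_of_ne_zero (evalHom_gen hy)
  intro h0
  exact nonZeroDivisors.ne_zero (h h0) (map_zero evalHom)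


/-- `0 ∉ ℐ`; consequently the localization `ℛ` of `ℤ[v^{±1}, s^{±1}]` at `ℐ` is an integral
domain and the canonical localization map is injective. -/
theorem zero_not_mem_Imonoid_and_localization_isDomain :
    (0 : LaurentVS) ∉ Imonoid ∧
      IsDomain (Localization Imonoid) ∧
      Function.Injective (algebraMap LaurentVS (Localization Imonoid)) := by
  have h0 := zero_notMem_Imonoid
  have hle : Imonoid ≤ nonZeroDivisors LaurentVS := le_nonZeroDivisors_of_noZeroDivisors h0
  exact ⟨h0, IsLocalization.isDomain_localization hle, IsLocalization.injective _ hle⟩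
end

section
/- Let F be a field, V an F-vector space, and ψ : V → V an F-linear endomorphism. Let B_0 ⊆ B_1 ⊆ B_2 ⊆ … be an increasing chain of subspaces of V with ⋃_{n≥0} B_n = V, such that ψ(B_n) ⊆ B_n for every n ≥ 0, ψ(B_0) = 0, and for every n ≥ 1 the endomorphism of the quotient space B_n / B_{n−1} induced by ψ is injective. Then the image of ψ meets B_0 trivially, i.e. (range ψ) ∩ B_0 = 0. -/
/-- Let `F` be a field, `V` an `F`-vector space, and `ψ : V → V` a linear endomorphism.
Let `B₀ ⊆ B₁ ⊆ B₂ ⊆ …` be an increasing exhaustive chain of subspaces of `V`, each invariant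
under `ψ`, with `ψ(B₀) = 0`, and such that for every `n ≥ 1` the induced endomorphism of the
quotient `Bₙ / Bₙ₋₁` is injective (equivalently: `x ∈ Bₙ` and `ψ x ∈ Bₙ₋₁` imply `x ∈ Bₙ₋₁`).
Then the range of `ψ` meets `B₀` trivially. -/
theorem range_inf_bottom_filtration_eq_bot {F V : Type*} [Field F] [AddCommGroup V]
    [Module F V] (ψ : V →ₗ[F] V) (B : ℕ → Submodule F V)
    (hmono : Monotone B)
    (hexh : ∀ x : V, ∃ n : ℕ, x ∈ B n)
    (hinvar : ∀ n : ℕ, ∀ x ∈ B n, ψ x ∈ B n)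
    (hB0 : ∀ x ∈ B 0, ψ x = 0)
    (hinj : ∀ n : ℕ, 1 ≤ n → ∀ x ∈ B n, ψ x ∈ B (n - 1) → x ∈ B (n - 1)) :
    LinearMap.range ψ ⊓ B 0 = ⊥ := by
  rw [eq_bot_iff]
  rintro _ ⟨⟨x, rfl⟩, hx⟩
  have key : ∀ n : ℕ, x ∈ B n → x ∈ B 0 := by
    intro n
    induction n with
    | zero => exact id
    | succ k ih =>
      intro h
      exact ih (hinj (k + 1) (Nat.le_add_left 1 k) x h (hmono (Nat.zero_le _) hx))
  obtain ⟨n, hn⟩ := hexh x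
  exact (Submodule.mem_bot F).2 (hB0 x (key n hn))
end
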